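/- Suppose M is (odd, odd)-free and A_M admits ordinary retractions. Let g ∈ A_M, let X, Y ⊆ S, and set D = C_{X,Y} ∪ C_{Y,X}. Suppose that (1) there exist no h ∈ A_M and Z ⊊ S such that both A_{C_{X,Y}} and g·A_{C_{Y,X}}·g⁻¹ are contained in h·A_Z·h⁻¹, and (2) there exists s ∈ S \ D such that D is not contained in lk(s). Then there exist d ∈ A_M and H ⊆ S with H ⊊ C_{X,Y} or H ⊊ C_{Y,X}, such that A_{C_{X,Y}} ∩ g·A_{C_{Y,X}}·g⁻¹ ≤ d·A_H·d⁻¹. -/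

import Mathlib

/-- `altProd u v m` is the alternating product `u * v * u * v * ⋯` with `m` factors. -/
def altProd {G : Type*} [Monoid G] : G → G → ℕ → G
  | _, _, 0 => 1
  | u, v, n + 1 => u * altProd v u n

/-- The relation set of the Artin group of the labelled Coxeter matrix `M`
(label `⊤` meaning no relation). -/
def ArtinRels {S : Type*} (M : S → S → ℕ∞) : Set (FreeGroup S) :=
  { r | ∃ (s t : S) (m : ℕ), s ≠ t ∧ M s t = (m : ℕ∞) ∧
        r = altProd (FreeGroup.of s) (FreeGroup.of t) m *
            (altProd (FreeGroup.of t) (FreeGroup.of s) m)⁻¹ }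

/-- The Artin group of the labelled Coxeter matrix `M`. -/
abbrev ArtinGroup {S : Type*} (M : S → S → ℕ∞) :=
  PresentedGroup (ArtinRels M)

/-- The image in the Artin group of the generator `s`. -/
def agen {S : Type*} (M : S → S → ℕ∞) (s : S) : ArtinGroup M :=
  PresentedGroup.of s

/-- The standard parabolic subgroup of the Artin group generated by `X ⊆ S`. -/
def parabolic {S : Type*} (M : S → S → ℕ∞) (X : Set S) : Subgroup (ArtinGroup M) :=
  Subgroup.closure (agen M '' X)

/-- The conjugate `g H g⁻¹` of a subgroup `H`. -/
def conjSub {G : Type*} [Group G] (g : G) (H : Subgroup G) : Subgroup G :=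
  H.map (MulAut.conj g).toMonoidHom

/-- `ρ` is a retraction of `G` onto its subgroup `H`: its image is contained in `H`
and it fixes every element of `H`. -/
def IsRetraction {G : Type*} [Group G] (ρ : G →* G) (H : Subgroup G) : Prop :=
  (∀ g, ρ g ∈ H) ∧ ∀ h ∈ H, ρ h = h

/-- The extended natural number `x` is finite and odd. -/
def OddLab (x : ℕ∞) : Prop := ∃ m : ℕ, x = (m : ℕ∞) ∧ Odd m

/-- The extended natural number `x` is finite and even. -/
def EvenFin (x : ℕ∞) : Prop := ∃ m : ℕ, x = (m : ℕ∞) ∧ Even m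

/-- The extended natural number `x` is even or equal to `∞`. -/
def EvenOrInf (x : ℕ∞) : Prop := ∀ m : ℕ, x = (m : ℕ∞) → Even m

/-- `ρ` is the ordinary retraction of the Artin group of `M` onto the standard
parabolic subgroup over `X`: it is a retraction onto `A_X`, it fixes the generators
in `X`, it sends a generator `v ∉ X` joined to some `a ∈ X` by an odd label to `a`,
and it kills the generators `v ∉ X` all of whose labels towards `X` are even or `∞`. -/
def IsOrdinaryRetraction {S : Type*} (M : S → S → ℕ∞) (X : Set S)
    (ρ : ArtinGroup M →* ArtinGroup M) : Prop :=
  IsRetraction ρ (parabolic M X) ∧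
  (∀ s ∈ X, ρ (agen M s) = agen M s) ∧
  (∀ v ∉ X, ∀ a ∈ X, OddLab (M v a) → ρ (agen M v) = agen M a) ∧
  (∀ v ∉ X, (∀ a ∈ X, EvenOrInf (M v a)) → ρ (agen M v) = 1)

/-- `M` has no two consecutive odd-labelled edges. -/
def OddOddFree {S : Type*} (M : S → S → ℕ∞) : Prop :=
  ¬ ∃ s t u : S, s ≠ t ∧ t ≠ u ∧ s ≠ u ∧ OddLab (M s t) ∧ OddLab (M t u)

/-- `O_{X,Y}`: the elements of `X \ Y` joined to some element of `Y \ X` by an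
odd label. -/
def Oset {S : Type*} (M : S → S → ℕ∞) (X Y : Set S) : Set S :=
  {x | x ∈ X \ Y ∧ ∃ y ∈ Y \ X, OddLab (M x y)}

/-- `C_{X,Y} = (X ∩ Y) ∪ O_{X,Y}`. -/
def Cset {S : Type*} (M : S → S → ℕ∞) (X Y : Set S) : Set S :=
  (X ∩ Y) ∪ Oset M X Y

/-- The link of `s`: the vertices joined to `s` by a finite label. -/
def lkset {S : Type*} (M : S → S → ℕ∞) (s : S) : Set S :=
  {t | t ≠ s ∧ M s t ≠ ⊤}

section AltProd

variable {G K : Type*} [Group G] [Group K]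

theorem map_altProd (f : G →* K) (u v : G) (m : ℕ) :
    f (altProd u v m) = altProd (f u) (f v) m := by
  induction m generalizing u v with
  | zero => simp [altProd]
  | succ n ih => simp [altProd, ih]

theorem altProd_two_mul (u v : G) (k : ℕ) : altProd u v (2 * k) = (u * v) ^ k := by
  induction k with
  | zero => simp [altProd]
  | succ n ih => rw [Nat.mul_succ, altProd, altProd, ih, pow_succ', mul_assoc]

theorem altProd_two_mul_add_one (u v : G) (k : ℕ) :
    altProd u v (2 * k + 1) = (u * v) ^ k * u := by
  rw [altProd, altProd_two_mul, ← mul_pow_mul]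

theorem altProd_one_comm {m : ℕ} (hm : Even m) (u : G) : altProd u 1 m = altProd 1 u m := by
  obtain ⟨k, rfl⟩ := hm
  rw [← two_mul, altProd_two_mul, altProd_two_mul, one_mul, mul_one]

end AltProd

section Amalgam

variable {G : Type*} [Group G]

/-- `AltWord H W i j g` says that `g` is a nonempty product of elements lying alternately in
`H true \ W` and `H false \ W`, the first factor being in `H i` and the last one in `H j`. -/
inductive AltWord (H : Bool → Subgroup G) (W : Subgroup G) : Bool → Bool → G → Prop
  | single {i : Bool} {h : G} : h ∈ H i → h ∉ W → AltWord H W i i h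
  | cons {i j : Bool} {h g : G} : h ∈ H i → h ∉ W → AltWord H W (!i) j g → AltWord H W i j (h * g)

/-- `G` is the amalgam of `H true` and `H false` along their common subgroup `W`, witnessed by
a homomorphism to the abstract pushout that extends the canonical maps. -/
def IsAmalgam (H : Bool → Subgroup G) (W : Subgroup G) : Prop :=
  (⨆ i, H i) = ⊤ ∧ ∃ (hW : ∀ i, W ≤ H i)
    (f : G →* Monoid.PushoutI fun i => Subgroup.inclusion (hW i)),
    ∀ i (h : H i), f h = Monoid.PushoutI.of i h

namespace AltWord

variable {H : Bool → Subgroup G} {W : Subgroup G}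

theorem mul_left_mem (hW : ∀ i, W ≤ H i) {i j : Bool} {g w : G} (hg : AltWord H W i j g)
    (hw : w ∈ W) : AltWord H W i j (w * g) := by
  cases hg with
  | single h h' => exact single (mul_mem (hW _ hw) h) (by rwa [Subgroup.mul_mem_cancel_left _ hw])
  | cons h h' hg =>
    rw [← mul_assoc]
    exact cons (mul_mem (hW _ hw) h) (by rwa [Subgroup.mul_mem_cancel_left _ hw]) hg

theorem exists_mul_right (hW : ∀ i, W ≤ H i) {i j : Bool} {g u : G} (hg : AltWord H W i j g)
    (hj : j = !true) (hu : u ∈ H true) : ∃ k, AltWord H W i k (g * u) := by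
  induction hg with
  | single h h' =>
    subst hj
    by_cases huW : u ∈ W
    · exact ⟨_, single (mul_mem h (hW _ huW)) (by rwa [Subgroup.mul_mem_cancel_right _ huW])⟩
    · exact ⟨_, cons h h' (single hu huW)⟩
  | cons h h' _ ih =>
    obtain ⟨k, hk⟩ := ih hj
    exact ⟨k, by rw [mul_assoc]; exact cons h h' hk⟩

theorem exists_eq_mul_right {i j : Bool} {g : G} (hg : AltWord H W i j g) :
    (i = true ∧ g ∈ H true) ∨ ∃ g' b, b ∈ H true ∧ AltWord H W i false g' ∧ g = g' * b := by
  induction hg with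
  | @single i h hh hW =>
    cases i with
    | true => exact .inl ⟨rfl, hh⟩
    | false => exact .inr ⟨h, 1, one_mem _, single hh hW, by simp⟩
  | @cons i j h g hh hW hg ih =>
    rcases ih with ⟨hi, hgm⟩ | ⟨g', b, hb, hg', rfl⟩
    · obtain rfl : i = false := by simpa using hi
      exact .inr ⟨h, g, hgm, single hh hW, rfl⟩
    · exact .inr ⟨h * g', b, hb, cons hh hW hg', by rw [mul_assoc]⟩

theorem exists_eq_mul_mul {i j : Bool} {g : G} (hg : AltWord H W i j g) (hgU : g ∉ H true) :
    ∃ a g' b, a ∈ H true ∧ b ∈ H true ∧ AltWord H W false false g' ∧ g = a * g' * b := by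
  rcases hg.exists_eq_mul_right with ⟨-, h⟩ | ⟨g', b, hb, hg', rfl⟩
  · exact absurd h hgU
  cases i with
  | false => exact ⟨1, g', b, one_mem _, hb, hg', by simp⟩
  | true =>
    cases hg' with
    | cons h₁ _ h₂ => exact ⟨_, _, b, h₁, hb, h₂, rfl⟩

end AltWord

namespace IsAmalgam

variable {H : Bool → Subgroup G} {W : Subgroup G}

theorem mem_or_altWord (hA : IsAmalgam H W) (g : G) : g ∈ W ∨ ∃ i j, AltWord H W i j g := by
  obtain ⟨htop, hW, -⟩ := hA
  have key : ∀ i, ∀ h ∈ H i, ∀ g : G, (g ∈ W ∨ ∃ i j, AltWord H W i j g) →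
      (h * g ∈ W ∨ ∃ i j, AltWord H W i j (h * g)) := by
    intro i h hh g hg
    by_cases hhW : h ∈ W
    · rcases hg with hg | ⟨k, j, hg⟩
      · exact .inl (mul_mem hhW hg)
      · exact .inr ⟨k, j, hg.mul_left_mem hW hhW⟩
    rcases hg with hg | ⟨k, j, hg⟩
    · exact .inr ⟨i, i, .single (mul_mem hh (hW i hg))
        (by rwa [Subgroup.mul_mem_cancel_right _ hg])⟩
    obtain rfl | hk : k = i ∨ k = !i := by cases k <;> cases i <;> simp
    · cases hg with
      | single h₁ h₂ =>
        by_cases hmem : h * g ∈ W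
        · exact .inl hmem
        · exact .inr ⟨_, _, .single (mul_mem hh h₁) hmem⟩
      | @cons _ _ a b h₁ h₂ hb =>
        rw [← mul_assoc]
        by_cases hmem : h * a ∈ W
        · exact .inr ⟨_, _, hb.mul_left_mem hW hmem⟩
        · exact .inr ⟨_, _, .cons (mul_mem hh h₁) hmem hb⟩
    · subst hk
      exact .inr ⟨_, _, .cons hh hhW hg⟩
  suffices ∀ x : G, ∀ g : G, (g ∈ W ∨ ∃ i j, AltWord H W i j g) →
      (x * g ∈ W ∨ ∃ i j, AltWord H W i j (x * g)) by
    simpa using this g 1 (.inl (one_mem _))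
  intro x
  have hx : x ∈ ⨆ i, H i := htop ▸ Subgroup.mem_top x
  induction hx using Subgroup.iSup_induction' with
  | hp i x hx => exact key i x hx
  | h1 => simp
  | hmul x y _ _ ihx ihy =>
    intro g hg
    rw [mul_assoc]
    exact ihx _ (ihy _ hg)

theorem not_altWord (hA : IsAmalgam H W) {j k : Bool} {g : G} (h₁ : AltWord H W true j g)
    (h₂ : AltWord H W false k g) : False := by
  obtain ⟨-, hW, f, hf⟩ := hA
  obtain ⟨d⟩ := Monoid.PushoutI.NormalWord.transversal_nonempty
    (fun i => Subgroup.inclusion (hW i)) (fun i => Subgroup.inclusion_injective (hW i))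
  have key : ∀ {i j g}, AltWord H W i j g →
      ∃ w : Monoid.PushoutI.NormalWord d, w.prod = f g ∧ w.fstIdx = some i := by
    have hr : ∀ {i} {h : G} (hh : h ∈ H i), h ∉ W →
        (⟨h, hh⟩ : H i) ∉ (Subgroup.inclusion (hW i)).range := by
      rintro i h hh hhW ⟨x, hx⟩
      have hxh : (x : G) = h := congrArg Subtype.val hx
      exact hhW (hxh ▸ x.2)
    intro i j g hg
    induction hg with
    | @single i h hh hhW =>
      refine ⟨Monoid.PushoutI.NormalWord.cons (⟨h, hh⟩ : H i) .empty
        (by simp [Monoid.CoprodI.Word.fstIdx]) (hr hh hhW), ?_, ?_⟩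
      · rw [Monoid.PushoutI.NormalWord.prod_cons, Monoid.PushoutI.NormalWord.prod_empty, mul_one,
          ← hf]
      · simp [Monoid.PushoutI.NormalWord.cons]
    | @cons i j h g hh hhW hg ih =>
      obtain ⟨w, hw, hi⟩ := ih
      refine ⟨Monoid.PushoutI.NormalWord.cons (⟨h, hh⟩ : H i) w (by simp [hi])
        (hr hh hhW), ?_, ?_⟩
      · rw [Monoid.PushoutI.NormalWord.prod_cons, hw, map_mul, ← hf]
      · simp [Monoid.PushoutI.NormalWord.cons]
  obtain ⟨w₁, hw₁, hi₁⟩ := key h₁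
  obtain ⟨w₂, hw₂, hi₂⟩ := key h₂
  obtain rfl := Monoid.PushoutI.NormalWord.prod_injective (hw₁.trans hw₂.symm)
  simp [hi₁] at hi₂

/-- In an amalgam, the intersection of the factor `H true` with a conjugate by an element `g`
outside of it lies in a conjugate of the amalgamated subgroup that depends only on `g`. -/
theorem exists_forall_conj_mem (hA : IsAmalgam H W) {g : G} (hg : g ∉ H true) :
    ∃ a ∈ H true, ∀ x ∈ H true, g⁻¹ * x * g ∈ H true → a⁻¹ * x * a ∈ W := by
  have hW : ∀ i, W ≤ H i := hA.2.1
  rcases hA.mem_or_altWord g with h | ⟨i, j, h⟩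
  · exact absurd (hW _ h) hg
  obtain ⟨a, g', b, ha, hb, hg', rfl⟩ := h.exists_eq_mul_mul hg
  refine ⟨a, ha, fun x hx hxg => ?_⟩
  by_contra hxW
  have h₁ : AltWord H W true false (a⁻¹ * x * a * g') :=
    .cons (mul_mem (mul_mem (inv_mem ha) hx) ha) hxW hg'
  obtain ⟨k, h₂⟩ := hg'.exists_mul_right hW rfl (mul_mem (mul_mem hb hxg) (inv_mem hb))
  refine hA.not_altWord h₁ (k := k) ?_
  convert h₂ using 1
  group

theorem altProd_ne (hA : IsAmalgam H W) {u v : G} (hu : u ∈ H true) (huW : u ∉ W)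
    (hv : v ∈ H false) (hvW : v ∉ W) {m : ℕ} (hm : m ≠ 0) :
    altProd u v m ≠ altProd v u m := by
  have key : ∀ n : ℕ, (∃ j, AltWord H W true j (altProd u v (n + 1))) ∧
      ∃ j, AltWord H W false j (altProd v u (n + 1)) := by
    intro n
    induction n with
    | zero => exact ⟨⟨true, by simpa [altProd] using .single hu huW⟩,
        ⟨false, by simpa [altProd] using .single hv hvW⟩⟩
    | succ n ih =>
      obtain ⟨⟨j, hj⟩, ⟨k, hk⟩⟩ := ih
      exact ⟨⟨k, .cons hu huW hk⟩, ⟨j, .cons hv hvW hj⟩⟩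
  obtain ⟨n, rfl⟩ := Nat.exists_eq_succ_of_ne_zero hm
  obtain ⟨⟨j, hj⟩, ⟨k, hk⟩⟩ := key n
  exact fun h => hA.not_altWord hj (h ▸ hk)

end IsAmalgam

end Amalgam

section Artin

variable {S : Type*} {M : S → S → ℕ∞}

theorem altProd_agen_comm {s t : S} {m : ℕ} (hst : s ≠ t) (hm : M s t = m) :
    altProd (agen M s) (agen M t) m = altProd (agen M t) (agen M s) m := by
  have h : PresentedGroup.mk (ArtinRels M) (altProd (FreeGroup.of s) (FreeGroup.of t) m *
      (altProd (FreeGroup.of t) (FreeGroup.of s) m)⁻¹) = 1 :=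
    PresentedGroup.one_of_mem ⟨s, t, m, hst, hm, rfl⟩
  rw [map_mul, map_inv, mul_inv_eq_one, map_altProd, map_altProd] at h
  exact h

theorem exists_artinLift {K : Type*} [Group K] (F : S → K)
    (hF : ∀ (s t : S) (m : ℕ), s ≠ t → M s t = m → altProd (F s) (F t) m = altProd (F t) (F s) m) :
    ∃ f : ArtinGroup M →* K, ∀ s, f (agen M s) = F s := by
  refine ⟨PresentedGroup.toGroup (f := F) ?_, fun s => PresentedGroup.toGroup.of _⟩
  rintro _ ⟨s, t, m, hst, hm, rfl⟩
  rw [map_mul, map_inv, map_altProd, map_altProd, mul_inv_eq_one]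
  simpa using hF s t m hst hm

theorem agen_mem_parabolic {X : Set S} {s : S} (hs : s ∈ X) : agen M s ∈ parabolic M X :=
  Subgroup.subset_closure ⟨s, hs, rfl⟩

theorem parabolic_mono {X Y : Set S} (h : X ⊆ Y) : parabolic M X ≤ parabolic M Y :=
  Subgroup.closure_mono (Set.image_mono h)

theorem mem_conjSub {G : Type*} [Group G] {g x : G} {H : Subgroup G} :
    x ∈ conjSub g H ↔ g⁻¹ * x * g ∈ H := by
  constructor
  · rintro ⟨y, hy, rfl⟩
    simpa [mul_assoc] using hy
  · exact fun h => ⟨_, h, by simp [mul_assoc]⟩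

theorem agen_ne_one (s : S) : agen M s ≠ 1 := by
  obtain ⟨f, hf⟩ := exists_artinLift (M := M) (fun _ => Multiplicative.ofAdd (1 : ℤ))
    (fun _ _ _ _ _ => rfl)
  intro h
  have := hf s
  rw [h, map_one] at this
  exact absurd this (by decide)

theorem agen_ne_agen_of_oddLab (hsymm : ∀ s t, M s t = M t s) (hge2 : ∀ s t, s ≠ t → 2 ≤ M s t)
    (hfree : OddOddFree M) {c l : S} (hcl : c ≠ l) (hodd : OddLab (M c l)) :
    agen M c ≠ agen M l := by
  classical
  obtain ⟨m, hm, hmo⟩ := hodd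
  have hm2 : 2 ≤ m := by
    have := hge2 c l hcl
    rw [hm] at this
    exact_mod_cast this
  have heven : ∀ (v w : S) (n : ℕ), (v = c ∨ v = l) → w ≠ c → w ≠ l → M v w = n → Even n := by
    intro v w n hv hwc hwl hn
    by_contra hne
    have hno : OddLab (M v w) := ⟨n, hn, Nat.not_even_iff_odd.mp hne⟩
    rcases hv with rfl | rfl
    · exact hfree ⟨l, v, w, hcl.symm, hwc.symm, hwl.symm, ⟨m, by rw [hsymm, hm], hmo⟩, hno⟩
    · exact hfree ⟨c, v, w, hcl, hwl.symm, hwc.symm, ⟨m, hm, hmo⟩, hno⟩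
  have hdih : altProd (DihedralGroup.sr 0 : DihedralGroup m) (DihedralGroup.sr 1) m =
      altProd (DihedralGroup.sr 1) (DihedralGroup.sr 0) m := by
    obtain ⟨k, hk⟩ := hmo
    have hz : ((2 * k + 1 : ℕ) : ZMod m) = 0 := by rw [← hk]; simp
    push_cast at hz
    have hodd : ∀ u v : DihedralGroup m, altProd u v m = (u * v) ^ k * u := fun u v => by
      rw [← altProd_two_mul_add_one, ← hk]
    rw [hodd, hodd]
    simp only [DihedralGroup.sr_mul_sr, DihedralGroup.r_pow, DihedralGroup.r_mul_sr]
    congr 1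
    linear_combination -hz
  obtain ⟨f, hf⟩ := exists_artinLift (M := M) (fun t => if t = c then
    (DihedralGroup.sr 0 : DihedralGroup m) else if t = l then DihedralGroup.sr 1 else 1) (by
      intro v w n hvw hn
      by_cases hv : v = c ∨ v = l <;> by_cases hw : w = c ∨ w = l
      · have hnm : n = m := by
          have : (n : ℕ∞) = m := by
            rw [← hn, ← hm]
            rcases hv with rfl | rfl <;> rcases hw with rfl | rfl <;> simp_all
          exact_mod_cast this
        subst hnm
        rcases hv with rfl | rfl <;> rcases hw with rfl | rfl
        · exact absurd rfl hvw
        · simpa [hvw.symm] using hdih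
        · simpa [hvw] using hdih.symm
        · exact absurd rfl hvw
      · push Not at hw
        simp only [if_neg hw.1, if_neg hw.2]
        exact altProd_one_comm (heven v w n hv hw.1 hw.2 hn) _
      · push Not at hv
        simp only [if_neg hv.1, if_neg hv.2]
        exact (altProd_one_comm (heven w v n hw hv.1 hv.2 (by rw [hsymm, hn])) _).symm
      · push Not at hv hw
        simp only [if_neg hv.1, if_neg hv.2, if_neg hw.1, if_neg hw.2])
  intro h
  have h' := congrArg f h
  rw [hf, hf, if_pos rfl, if_neg hcl.symm, if_pos rfl] at h'
  have h01 : (0 : ZMod m) = 1 := by simpa using h'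
  have : Fact (1 < m) := ⟨hm2⟩
  exact zero_ne_one h01

theorem IsOrdinaryRetraction.map_agen {Z : Set S} {ρ : ArtinGroup M →* ArtinGroup M}
    (hρ : IsOrdinaryRetraction M Z ρ) {v : S} (hv : v ∉ Z) :
    ρ (agen M v) = 1 ∨ ∃ a ∈ Z, OddLab (M v a) ∧ ρ (agen M v) = agen M a := by
  by_cases h : ∃ a ∈ Z, OddLab (M v a)
  · obtain ⟨a, ha, hva⟩ := h
    exact .inr ⟨a, ha, hva, hρ.2.2.1 v hv a ha hva⟩
  · push Not at h
    refine .inl (hρ.2.2.2 v hv fun a ha m hm => ?_)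
    by_contra hne
    exact h a ha ⟨m, hm, Nat.not_even_iff_odd.mp hne⟩

theorem mem_of_agen_mem_parabolic (hsymm : ∀ s t, M s t = M t s)
    (hge2 : ∀ s t, s ≠ t → 2 ≤ M s t) (hfree : OddOddFree M)
    (hord : ∀ Z : Set S, ∃ ρ : ArtinGroup M →* ArtinGroup M, IsOrdinaryRetraction M Z ρ)
    {Z : Set S} {s : S} (hs : agen M s ∈ parabolic M Z) : s ∈ Z := by
  by_contra hsZ
  obtain ⟨ρ, hρ⟩ := hord Z
  have hfix := hρ.1.2 _ hs
  rcases hρ.map_agen hsZ with h | ⟨a, ha, hodd, h⟩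
  · exact agen_ne_one s (hfix.symm.trans h)
  · exact agen_ne_agen_of_oddLab hsymm hge2 hfree (by rintro rfl; exact hsZ ha) hodd
      (hfix.symm.trans h)

/-- The vertex sets of the two factors in the splitting of an Artin group over the link of `s`. -/
def splitSet (M : S → S → ℕ∞) (s : S) : Bool → Set S
  | true => {t | t ≠ s}
  | false => insert s (lkset M s)

theorem isAmalgam_splitSet (hsymm : ∀ s t, M s t = M t s) (s : S) :
    IsAmalgam (fun i => parabolic M (splitSet M s i)) (parabolic M (lkset M s)) := by
  classical
  have hsub : ∀ i, lkset M s ⊆ splitSet M s i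
    | true => fun t ht => ht.1
    | false => Set.subset_insert _ _
  have hW : ∀ i, parabolic M (lkset M s) ≤ parabolic M (splitSet M s i) :=
    fun i => parabolic_mono (hsub i)
  refine ⟨?_, hW, ?_⟩
  · rw [eq_top_iff, ← PresentedGroup.closure_range_of, Subgroup.closure_le]
    rintro _ ⟨t, rfl⟩
    by_cases ht : t = s
    · exact Subgroup.mem_iSup_of_mem false (agen_mem_parabolic (M := M) (.inl ht))
    · exact Subgroup.mem_iSup_of_mem true (agen_mem_parabolic (M := M) ht)
  let gen (i : Bool) (t : S) (ht : t ∈ splitSet M s i) :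
      Monoid.PushoutI fun i => Subgroup.inclusion (hW i) :=
    Monoid.PushoutI.of i (⟨agen M t, agen_mem_parabolic ht⟩ : parabolic M (splitSet M s i))
  have hgen_lk : ∀ t (ht : t ∈ lkset M s) i,
      gen i t (hsub i ht) = Monoid.PushoutI.base _ ⟨agen M t, agen_mem_parabolic ht⟩ := by
    intro t ht i
    rw [← Monoid.PushoutI.of_apply_eq_base _ i]
    rfl
  let F (t : S) := if ht : t = s then gen false t (.inl ht) else gen true t ht
  have hF : ∀ i t (ht : t ∈ splitSet M s i), F t = gen i t ht := by
    intro i t ht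
    by_cases hts : t = s
    · cases i with
      | true => exact absurd hts ht
      | false => simp only [F, dif_pos hts]
    · cases i with
      | true => simp only [F, dif_neg hts]
      | false =>
        have htl : t ∈ lkset M s := ht.resolve_left hts
        simp only [F, dif_neg hts]
        exact (hgen_lk t htl true).trans (hgen_lk t htl false).symm
  have hrel : ∀ (t t' : S) (m : ℕ), t ≠ t' → M t t' = m →
      altProd (F t) (F t') m = altProd (F t') (F t) m := by
    intro t t' m htt' hm
    obtain ⟨i, hi, hi'⟩ : ∃ i, t ∈ splitSet M s i ∧ t' ∈ splitSet M s i := by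
      by_cases ht : t = s
      · subst ht
        exact ⟨false, .inl rfl, .inr ⟨htt'.symm, by simp [hm]⟩⟩
      by_cases ht' : t' = s
      · subst ht'
        exact ⟨false, .inr ⟨htt', by simp [hsymm t' t, hm]⟩, .inl rfl⟩
      exact ⟨true, ht, ht'⟩
    rw [hF i t hi, hF i t' hi', ← map_altProd, ← map_altProd]
    congr 1
    apply Subtype.ext
    rw [← Subgroup.coe_subtype, map_altProd, map_altProd]
    exact altProd_agen_comm htt' hm
  obtain ⟨f, hf⟩ := exists_artinLift F hrel
  refine ⟨f, fun i h => ?_⟩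
  obtain ⟨h, hh⟩ := h
  induction hh using Subgroup.closure_induction with
  | mem x hx =>
    obtain ⟨t, ht, rfl⟩ := hx
    exact (hf t).trans (hF i t ht)
  | one => exact (map_one f).trans (map_one _).symm
  | mul x y hx hy ihx ihy =>
    exact (map_mul f x y).trans ((congrArg₂ _ ihx ihy).trans (map_mul _ _ _).symm)
  | inv x hx ihx => exact (map_inv f x).trans ((congrArg _ ihx).trans (map_inv _ _).symm)

/-- Labels from `s` to the two ends of an odd edge are simultaneously finite. -/
theorem ne_top_of_oddLab (hsymm : ∀ s t, M s t = M t s)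
    (hge2 : ∀ s t, s ≠ t → 2 ≤ M s t) (hfree : OddOddFree M)
    (hord : ∀ Z : Set S, ∃ ρ : ArtinGroup M →* ArtinGroup M, IsOrdinaryRetraction M Z ρ)
    {s c l : S} (hsc : c ≠ s) (hsl : l ≠ s) (hodd : OddLab (M l c)) (hfin : M s l ≠ ⊤) :
    M s c ≠ ⊤ := by
  intro htop
  obtain ⟨m, hm⟩ := ENat.ne_top_iff_exists.mp hfin
  have hlc : l ≠ c := by
    rintro rfl
    exact hfin htop
  have hm0 : m ≠ 0 := by
    rintro rfl
    simpa [← hm] using hge2 s l hsl.symm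
  obtain ⟨ρ, hρ⟩ := hord {s, c}
  have hrel := congrArg ρ (altProd_agen_comm hsl.symm hm.symm)
  rw [map_altProd, map_altProd, hρ.2.1 s (by simp),
    hρ.2.2.1 l (by simp [hsl, hlc]) c (by simp) hodd] at hrel
  have hmem {Z : Set S} {t : S} : agen M t ∈ parabolic M Z → t ∈ Z :=
    mem_of_agen_mem_parabolic hsymm hge2 hfree hord
  exact (isAmalgam_splitSet hsymm s).altProd_ne (agen_mem_parabolic (X := splitSet M s true) hsc)
    (fun h => (hmem h).2 htop) (agen_mem_parabolic (X := splitSet M s false) (.inl rfl))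
    (fun h => (hmem h).1 rfl) hm0 hrel.symm

theorem IsOrdinaryRetraction.map_mem_parabolic_inter {C L : Set S}
    {ρ : ArtinGroup M →* ArtinGroup M} (hρ : IsOrdinaryRetraction M C ρ)
    (hCL : ∀ l ∈ L, ∀ c ∈ C, OddLab (M l c) → c ∈ L) {w : ArtinGroup M}
    (hw : w ∈ parabolic M L) : ρ w ∈ parabolic M (C ∩ L) := by
  suffices parabolic M L ≤ (parabolic M (C ∩ L)).comap ρ from this hw
  rw [parabolic, Subgroup.closure_le]
  rintro _ ⟨l, hl, rfl⟩
  change ρ (agen M l) ∈ parabolic M (C ∩ L)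
  by_cases hlC : l ∈ C
  · rw [hρ.2.1 l hlC]
    exact agen_mem_parabolic ⟨hlC, hl⟩
  · rcases hρ.map_agen hlC with h | ⟨c, hc, hodd, h⟩ <;> rw [h]
    · exact one_mem _
    · exact agen_mem_parabolic ⟨hc, hCL l hl c hc hodd⟩

theorem exists_ssubset_forall_conj_mem (hsymm : ∀ s t, M s t = M t s)
    (hge2 : ∀ s t, s ≠ t → 2 ≤ M s t) (hfree : OddOddFree M)
    (hord : ∀ Z : Set S, ∃ ρ : ArtinGroup M →* ArtinGroup M, IsOrdinaryRetraction M Z ρ)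
    {s : S} {C : Set S} (hsC : s ∉ C) (hC : ¬ C ⊆ lkset M s) {g : ArtinGroup M}
    (hg : g ∉ parabolic M {t | t ≠ s}) :
    ∃ (d : ArtinGroup M) (H : Set S), H ⊂ C ∧ ∀ x ∈ parabolic M C,
      g⁻¹ * x * g ∈ parabolic M {t | t ≠ s} → d⁻¹ * x * d ∈ parabolic M H := by
  obtain ⟨a, -, ha⟩ := (isAmalgam_splitSet hsymm s).exists_forall_conj_mem hg
  obtain ⟨ρ, hρ⟩ := hord C
  have hCs : ∀ c ∈ C, c ≠ s := by
    rintro c hc rfl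
    exact hsC hc
  refine ⟨ρ a, C ∩ lkset M s, ⟨Set.inter_subset_left, fun h => hC fun c hc => (h hc).2⟩,
    fun x hx hxg => ?_⟩
  have hCL : ∀ l ∈ lkset M s, ∀ c ∈ C, OddLab (M l c) → c ∈ lkset M s :=
    fun l hl c hc hodd => ⟨hCs c hc,
      ne_top_of_oddLab hsymm hge2 hfree hord (hCs c hc) hl.1 hodd hl.2⟩
  have hw := hρ.map_mem_parabolic_inter hCL (ha x (parabolic_mono hCs hx) hxg)
  rwa [map_mul, map_mul, map_inv, hρ.1.2 x hx] at hw

end Artin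

/-- In an (odd, odd)-free Artin group admitting ordinary retractions, suppose
`A_{C_{X,Y}} ∪ g A_{C_{Y,X}} g⁻¹` is not contained in a proper parabolic subgroup
and some `s ∈ S \ D`, with `D = C_{X,Y} ∪ C_{Y,X}`, satisfies `D ⊄ lk(s)`. Then
`A_{C_{X,Y}} ∩ g A_{C_{Y,X}} g⁻¹` is contained in a parabolic subgroup over a
proper subset of `C_{X,Y}` or of `C_{Y,X}`. -/
theorem intersection_in_smaller_parabolic {S : Type*} [Fintype S] (M : S → S → ℕ∞)
    (hsymm : ∀ s t, M s t = M t s) (hdiag : ∀ s, M s s = 1)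
    (hge2 : ∀ s t, s ≠ t → 2 ≤ M s t)
    (hfree : OddOddFree M)
    (hord : ∀ Z : Set S, ∃ ρ : ArtinGroup M →* ArtinGroup M,
      IsOrdinaryRetraction M Z ρ)
    (g : ArtinGroup M) (X Y : Set S)
    (hproper : ¬ ∃ (h : ArtinGroup M) (Z : Set S), Z ≠ Set.univ ∧
      parabolic M (Cset M X Y) ≤ conjSub h (parabolic M Z) ∧
      conjSub g (parabolic M (Cset M Y X)) ≤ conjSub h (parabolic M Z))
    (hs : ∃ s : S, s ∉ Cset M X Y ∪ Cset M Y X ∧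
      ¬ (Cset M X Y ∪ Cset M Y X) ⊆ lkset M s) :
    ∃ (d : ArtinGroup M) (H : Set S),
      (H ⊂ Cset M X Y ∨ H ⊂ Cset M Y X) ∧
      parabolic M (Cset M X Y) ⊓ conjSub g (parabolic M (Cset M Y X)) ≤
        conjSub d (parabolic M H) := by
  obtain ⟨s, hsD, hlk⟩ := hs
  have hsC : s ∉ Cset M X Y := fun h => hsD (.inl h)
  have hsC' : s ∉ Cset M Y X := fun h => hsD (.inr h)
  have hC : Cset M X Y ⊆ {t | t ≠ s} := fun t ht h => hsC (h ▸ ht)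
  have hC' : Cset M Y X ⊆ {t | t ≠ s} := fun t ht h => hsC' (h ▸ ht)
  have hg : g ∉ parabolic M {t | t ≠ s} := by
    intro hg
    refine hproper ⟨1, {t | t ≠ s}, fun h => (h ▸ Set.mem_univ s : s ∈ {t | t ≠ s}) rfl, ?_, ?_⟩
    · exact fun x hx => mem_conjSub.mpr (by simpa using parabolic_mono hC hx)
    · intro x hx
      have hx' := parabolic_mono hC' (mem_conjSub.mp hx)
      rw [mem_conjSub, inv_one, one_mul, mul_one]
      simpa [mul_assoc] using mul_mem (mul_mem hg hx') (inv_mem hg)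
  rw [Set.union_subset_iff, not_and_or] at hlk
  rcases hlk with hlk | hlk
  · obtain ⟨d, H, hH, hd⟩ := exists_ssubset_forall_conj_mem hsymm hge2 hfree hord hsC hlk hg
    exact ⟨d, H, .inl hH, fun x hx => mem_conjSub.mpr
      (hd x hx.1 (parabolic_mono hC' (mem_conjSub.mp hx.2)))⟩
  · obtain ⟨d, H, hH, hd⟩ := exists_ssubset_forall_conj_mem hsymm hge2 hfree hord hsC' hlk
      (fun h => hg (inv_mem_iff.mp h) : g⁻¹ ∉ parabolic M {t | t ≠ s})
    refine ⟨g * d, H, .inr hH, fun x hx => mem_conjSub.mpr ?_⟩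
    have := hd _ (mem_conjSub.mp hx.2) (by simpa [mul_assoc] using parabolic_mono hC hx.1)
    simpa [mul_assoc] using this
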